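/- The containment relation up to an unknown bounded regular resynchronizer is undecidable: there is no algorithm that decides, given (codes of) two one-way nondeterministic transducers T₁ and T₂, whether T₁ ⪯ T₂, i.e., whether there exists a bounded regular resynchronizer R with ⟦T₁⟧ᵒ ⊆ R(⟦T₂⟧ᵒ). (In particular the problem is undecidable for two-way nondeterministic transducers.) -/

import Mathlib

/-- An annotated letter over `Σ × {0,1}^(m+2)`: an input letter together with `m`
parameter bits and two marker bits (for the source position `x` and target position `y`). -/
abbrev RLetter (Sig : Type) (m : ℕ) : Type :=
  Sig × (Fin m → Bool) × Bool × Bool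

/-- The word over `Σ × {0,1}^(m+2)` annotating `u` with the parameter valuation `Ī`
(positions are 1-indexed, parameters given by their characteristic functions) and with
marker bits at positions `x` and `y`. -/
def annot {Sig : Type} {m : ℕ} (u : List Sig) (I : Fin m → ℕ → Bool)
    (x y : ℕ) : List (RLetter Sig m) :=
  u.mapIdx fun j a => (a, fun i => I i (j + 1), decide (j + 1 = x), decide (j + 1 = y))

/-- `(u, Ī, x, y) ⊨ γ`. -/
def RSat {Sig : Type} {m : ℕ} (γ : Set (List (RLetter Sig m)))
    (u : List Sig) (I : Fin m → ℕ → Bool) (x y : ℕ) : Prop :=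
  annot u I x y ∈ γ

/-- A language is regular if it is accepted by a deterministic finite automaton. -/
def IsRegularLang {α : Type} (L : Set (List α)) : Prop :=
  ∃ (Q : Type) (_ : Fintype Q) (M : DFA α Q), M.accepts = L

/-- A resynchronizer (given by its language `γ` with `m` input parameters) is bounded by `k`
if for every input word `u`, parameters `Ī` and position `y` of `u`, there are at most `k`
distinct positions `x` of `u` with `(u, Ī, x, y) ⊨ γ`. -/
def BoundedBy {Sig : Type} {m : ℕ} (γ : Set (List (RLetter Sig m))) (k : ℕ) : Prop :=
  ∀ (u : List Sig) (I : Fin m → ℕ → Bool) (y : ℕ), 1 ≤ y → y ≤ u.length →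
    {x : ℕ | 1 ≤ x ∧ x ≤ u.length ∧ RSat γ u I x y}.ncard ≤ k

/-- A resynchronizer is bounded if it is bounded by some `k`. -/
def BoundedResync {Sig : Type} {m : ℕ} (γ : Set (List (RLetter Sig m))) : Prop :=
  ∃ k, BoundedBy γ k

/-- An origin graph: a nonempty input word `u`, an output word `v`, and an origin map
sending every (1-indexed) position of `v` to a position of `u`. -/
structure OriginGraph (Sig Gam : Type) where
  inp : List Sig
  out : List Gam
  orig : ℕ → ℕ
  inp_ne : inp ≠ []
  orig_mem : ∀ t, 1 ≤ t → t ≤ out.length → 1 ≤ orig t ∧ orig t ≤ inp.length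

/-- `(g, g') ∈ ⟦R⟧` for the resynchronizer with language `γ`: same input and output,
and for some choice of input parameters, every output position has its `g`-origin
redirected to its `g'`-origin as allowed by `γ`. -/
def ResyncRel {Sig Gam : Type} {m : ℕ} (γ : Set (List (RLetter Sig m)))
    (g g' : OriginGraph Sig Gam) : Prop :=
  g.inp = g'.inp ∧ g.out = g'.out ∧
    ∃ I : Fin m → ℕ → Bool,
      ∀ z, 1 ≤ z → z ≤ g'.out.length → RSat γ g.inp I (g.orig z) (g'.orig z)

/-- `S₁ ⊆ R(S₂)` for the resynchronizer with language `γ`. -/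
def ContainedUpTo {Sig Gam : Type} {m : ℕ} (γ : Set (List (RLetter Sig m)))
    (S₁ S₂ : Set (OriginGraph Sig Gam)) : Prop :=
  ∀ g₁ ∈ S₁, ∃ g₂ ∈ S₂, ResyncRel γ g₂ g₁

/-- `S₁ ⪯ S₂`: there is a bounded regular resynchronizer `R` with `S₁ ⊆ R(S₂)`. -/
def ResyncLE {Sig Gam : Type} (S₁ S₂ : Set (OriginGraph Sig Gam)) : Prop :=
  ∃ (m : ℕ) (γ : Set (List (RLetter Sig m))),
    IsRegularLang γ ∧ BoundedResync γ ∧ ContainedUpTo γ S₁ S₂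

/-- Input position `x` traverses input position `z` (with respect to the pair `(g, g')`). -/
def Traverses {Sig Gam : Type} (g g' : OriginGraph Sig Gam) (x z : ℕ) : Prop :=
  ∃ t, 1 ≤ t ∧ t ≤ g.out.length ∧ g.orig t = x ∧
    ((x ≤ z ∧ z < g'.orig t) ∨ (g'.orig t < z ∧ z ≤ x))

/-- The pair `(g, g')` has `k`-traversal: every input position `z` is traversed by at
most `k` distinct positions. -/
def HasTraversal {Sig Gam : Type} (k : ℕ) (g g' : OriginGraph Sig Gam) : Prop :=
  ∀ z, 1 ≤ z → z ≤ g.inp.length → {x : ℕ | Traverses g g' x z}.ncard ≤ k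


/-- A transition of a one-way nondeterministic transducer: source state, input letter
(`none` for an ε-transition), output word, target state. States and letters are
natural numbers. -/
abbrev NTrans : Type := ℕ × Option ℕ × List ℕ × ℕ

/-- A one-way nondeterministic transducer (1NT), as a finite object: the list of
transitions, the list of initial states and the list of final states. -/
abbrev NT1 : Type := List NTrans × List ℕ × List ℕ

/-- Given the number `c` of input letters consumed so far, compute from a sequence of
transitions the triple (input word, output word, list of origins of the output positions).
The output produced while reading the input letter at position `j` gets origin `j`;
output produced by an ε-transition gets as origin the last input position read so far
(position `1` if no input has been read yet, position `|u|` if the whole input has been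
consumed). -/
def runData : ℕ → List NTrans → List ℕ × List ℕ × List ℕ
  | _, [] => ([], [], [])
  | c, tr :: rest =>
    match tr.2.1 with
    | some a =>
        let r := runData (c + 1) rest
        (a :: r.1, tr.2.2.1 ++ r.2.1, tr.2.2.1.map (fun _ => c + 1) ++ r.2.2)
    | none =>
        let r := runData c rest
        (r.1, tr.2.2.1 ++ r.2.1, tr.2.2.1.map (fun _ => max c 1) ++ r.2.2)

/-- `ts` is (the sequence of transitions of) an accepting run of the 1NT `T`. -/
def IsRun (T : NT1) (ts : List NTrans) : Prop :=
  ts ≠ [] ∧ (∀ tr ∈ ts, tr ∈ T.1) ∧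
    (ts.head?.elim False fun tr => tr.1 ∈ T.2.1) ∧
    (ts.getLast?.elim False fun tr => tr.2.2.2 ∈ T.2.2) ∧
    ts.Chain' (fun s t => s.2.2.2 = t.1)

/-- The origin semantics `⟦T⟧ᵒ` of a 1NT: the set of origin graphs of accepting runs
of `T` (on nonempty inputs). -/
def OSem (T : NT1) : Set (OriginGraph ℕ ℕ) :=
  { g | ∃ ts, IsRun T ts ∧
      g.inp = (runData 0 ts).1 ∧
      g.out = (runData 0 ts).2.1 ∧
      ∀ z, 1 ≤ z → z ≤ g.out.length → g.orig z = ((runData 0 ts).2.2).getD (z - 1) 1 }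


section QueueMachine
open Turing

theorem partrec_haltAtPow :
    ∃ f : ℕ →. ℕ, Partrec f ∧ ∀ n, (f (2 ^ n)).Dom ↔
      (Nat.Partrec.Code.eval (Denumerable.ofNat Nat.Partrec.Code n) 0).Dom := by
  have hpow : Primrec fun n : ℕ => 2 ^ n := by
    have : Primrec fun n : ℕ => Nat.rec (motive := fun _ => ℕ) 1 (fun _ r => 2 * r) n :=
      Primrec.nat_rec₁ 1 (Primrec.nat_mul.comp (Primrec.const 2) Primrec.snd).to₂
    refine this.of_eq fun n => ?_
    induction n with
    | zero => rfl
    | succ n ih => simp only [pow_succ, ← ih]; ring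
  let p (m : ℕ) : ℕ →. Bool := fun k => Part.some (decide (2 ^ k = m))
  have hsearch : Partrec fun m : ℕ => Nat.rfind (p m) := by
    refine Partrec.rfind ?_
    have : PrimrecRel fun (m k : ℕ) => 2 ^ k = m :=
      Primrec.eq.comp (hpow.comp Primrec.snd) Primrec.fst
    exact this.decide.to_comp.partrec₂
  have hspec (n : ℕ) : Nat.rfind (p (2 ^ n)) = Part.some n := by
    refine Part.eq_some_iff.2 (Nat.mem_rfind.2 ⟨by simp [p], fun {m} hm => ?_⟩)
    have : 2 ^ m ≠ 2 ^ n := fun h => hm.ne (Nat.pow_right_injective le_rfl h)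
    simp [p, this]
  refine ⟨fun m => (Nat.rfind (p m)).bind fun n =>
    Nat.Partrec.Code.eval (Denumerable.ofNat Nat.Partrec.Code n) 0, ?_, fun n => ?_⟩
  · refine hsearch.bind ?_
    exact Nat.Partrec.Code.eval_part.comp
      ((Primrec.ofNat _).to_comp.comp Computable.snd) (Computable.const 0)
  · change ((Nat.rfind (p (2 ^ n))).bind _).Dom ↔ _
    rw [hspec, Part.bind_some]

theorem trNat_two_pow (n : ℕ) :
    PartrecToTM2.trNat (2 ^ n) = List.replicate n .bit0 ++ [.bit1] := by
  have h : ∀ n, ∃ p : PosNum, ((2 ^ n : ℕ) : Num) = Num.pos p ∧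
      PartrecToTM2.trPosNum p = List.replicate n .bit0 ++ [.bit1] := by
    intro n
    induction n with
    | zero => exact ⟨1, rfl, rfl⟩
    | succ n ih =>
      obtain ⟨p, hp, hw⟩ := ih
      refine ⟨.bit0 p, ?_, ?_⟩
      · rw [pow_succ, mul_two, Nat.cast_add, hp, Num.bit0_of_bit0]
        rfl
      · rw [PartrecToTM2.trPosNum, hw, List.replicate_succ, List.cons_append]
  obtain ⟨p, hp, hw⟩ := h n
  rw [PartrecToTM2.trNat, hp, PartrecToTM2.trNum, hw]

/-- Some Turing machine halts on the input `a b xⁿ` exactly if the `n`-th code halts on `0`. -/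
theorem exists_TM0 :
    ∃ (Γ Λ : Type) (_ : Inhabited Γ) (_ : Inhabited Λ) (_ : Finite Γ) (M : TM0.Machine Γ Λ)
      (S : Set Λ) (a b x : Γ), S.Finite ∧ TM0.Supports M S ∧
      ∀ n : ℕ, (TM0.eval M (a :: b :: List.replicate n x)).Dom ↔
        (Nat.Partrec.Code.eval (Denumerable.ofNat Nat.Partrec.Code n) 0).Dom := by
  classical
  obtain ⟨f, hf, hfn⟩ := partrec_haltAtPow
  obtain ⟨c, hc⟩ := ToPartrec.Code.exists_code (Nat.Partrec'.part_iff₁.2 hf)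
  let _ : Inhabited PartrecToTM2.Λ' := ⟨PartrecToTM2.trNormal c .halt⟩
  let M : PartrecToTM2.Λ' → TM2.Stmt (fun _ : PartrecToTM2.K' => PartrecToTM2.Γ') PartrecToTM2.Λ'
    (Option PartrecToTM2.Γ') := PartrecToTM2.tr
  have hfin : Finite (TM2to1.Γ' PartrecToTM2.K' fun _ => PartrecToTM2.Γ') := by
    have : Finite PartrecToTM2.K' :=
      Finite.of_injective (β := Fin 4) (fun k => PartrecToTM2.K'.casesOn k 0 1 2 3) (by
        rintro (_ | _ | _ | _) (_ | _ | _ | _) h <;> first | rfl | simp at h)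
    unfold TM2to1.Γ'
    infer_instance
  let s (y : PartrecToTM2.Γ') : PartrecToTM2.K' → Option PartrecToTM2.Γ' :=
    Function.update (fun _ => none) .main (some y)
  refine ⟨TM2to1.Γ' PartrecToTM2.K' fun _ => PartrecToTM2.Γ', _, inferInstance, inferInstance, hfin,
    TM1to0.tr (TM2to1.tr M), _, (true, s .cons), (false, s .bit1), (false, s .bit0),
    Finset.finite_toSet _,
    TM1to0.tr_supports _ (TM2to1.tr_supports _ (PartrecToTM2.tr_supports c .halt)), fun n => ?_⟩
  have hinit : TM2to1.trInit PartrecToTM2.K'.main (PartrecToTM2.trList [2 ^ n]) =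
      ((true, s .cons) :: (false, s .bit1) :: List.replicate n (false, s .bit0) :
        List (TM2to1.Γ' PartrecToTM2.K' fun _ => PartrecToTM2.Γ')) := by
    have hrev : (PartrecToTM2.trList [2 ^ n]).reverse = .cons :: .bit1 :: List.replicate n .bit0 := by
      simp [trNat_two_pow]
    let g (y : PartrecToTM2.Γ') : TM2to1.Γ' PartrecToTM2.K' fun _ => PartrecToTM2.Γ' := (false, s y)
    refine (congrArg (fun l => (true, (l.map g).headI.2) :: (l.map g).tail) hrev).trans ?_
    exact congrArg (fun l => (true, s .cons) :: (false, s .bit1) :: l) List.map_replicate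
  have h1 : (PartrecToTM2.init c [2 ^ n] : TM2.Cfg _ _ _) =
      TM2.init .main (PartrecToTM2.trList [2 ^ n]) := by
    unfold PartrecToTM2.init TM2.init
    congr 1
    funext k
    cases k <;> rfl
  have h2 : StateTransition.eval (TM2.step M) (TM2.init .main (PartrecToTM2.trList [2 ^ n])) =
      PartrecToTM2.halt <$> c.eval [2 ^ n] := h1 ▸ PartrecToTM2.tr_eval c [2 ^ n]
  have h3 : c.eval [2 ^ n] = pure <$> f (2 ^ n) := hc ⟨[2 ^ n], rfl⟩
  have h4 : (StateTransition.eval (TM2.step M)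
      (TM2.init .main (PartrecToTM2.trList [2 ^ n]))).Dom ↔ (f (2 ^ n)).Dom := by
    rw [h2, h3]; rfl
  rw [← hinit, TM1to0.tr_eval, TM2to1.tr_eval_dom, ← hfn n]
  exact h4

/-- The run of a deterministic sequential transducer `δ` from a state on an input word: the state
reached and the output produced, or `none` if a transition is missing. -/
def gsmRun {σ α β : Type} (δ : σ → α → Option (σ × List β)) : σ → List α → Option (σ × List β)
  | q, [] => some (q, [])
  | q, a :: u => (δ q a).bind fun p => (gsmRun δ p.1 u).map fun r => (r.1, p.2 ++ r.2)

section GSM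
variable {σ α β : Type} (δ : σ → α → Option (σ × List β))

theorem gsmRun_append (q : σ) (u v : List α) :
    gsmRun δ q (u ++ v) =
      (gsmRun δ q u).bind fun p => (gsmRun δ p.1 v).map fun r => (r.1, p.2 ++ r.2) := by
  induction u generalizing q with
  | nil => simp [gsmRun]
  | cons a u ih =>
    simp only [List.cons_append, gsmRun, ih]
    cases δ q a with
    | none => rfl
    | some p =>
      simp only [Option.bind_some]
      cases gsmRun δ p.1 u with
      | none => rfl
      | some r => simp [Function.comp_def]

theorem gsmRun_append_of_eq_some {q r : σ} {u : List α} {o : List β}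
    (h : gsmRun δ q u = some (r, o)) (v : List α) :
    gsmRun δ q (u ++ v) = (gsmRun δ r v).map fun p => (p.1, o ++ p.2) := by
  rw [gsmRun_append, h, Option.bind_some]

theorem gsmRun_append_of_eq_none {q : σ} {u : List α} (h : gsmRun δ q u = none) (v : List α) :
    gsmRun δ q (u ++ v) = none := by
  rw [gsmRun_append, h, Option.bind_none]

end GSM

section Tape
variable {Γ Λ : Type}

/-- Letters of the queue: `none` separates configurations, `some (a, none)` is a tape symbol and
`some (a, some q)` is the symbol under the head, together with the machine state. -/
abbrev QLetter (Γ Λ : Type) : Type := Option (Γ × Option Λ)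

/-- Control states of the queue machine: `inl o` copies the part left of the head, holding back
the symbol `o`; `inr (some q)` has to place the head on the next symbol, in state `q`;
`inr none` copies the part right of the head. -/
abbrev QState (Γ Λ : Type) : Type := Option Γ ⊕ Option Λ

/-- A tape symbol as a queue letter. -/
def symLetter (a : Γ) : QLetter Γ Λ := some (a, none)

/-- A machine configuration given by state, scanned symbol, and the words to the left (read
towards the left) and to the right of the head. -/
abbrev TapeCfg (Γ Λ : Type) : Type := Λ × Γ × List Γ × List Γ

variable [Inhabited Γ] (M : Λ → Γ → Option (Λ × TM0.Stmt Γ))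

/-- One step of a Turing machine on a configuration with an explicit finite tape. -/
def tapeStep : TapeCfg Γ Λ → Option (TapeCfg Γ Λ)
  | (q, a, L, R) => (M q a).map fun p => match p.2 with
    | .move .left => (p.1, L.headI, L.tail, a :: R)
    | .move .right => (p.1, R.headI, a :: L, R.tail)
    | .write b => (p.1, b, L, R)

/-- The sequential transducer that maps the code of a configuration to that of its successor. -/
def queueStep : QState Γ Λ → QLetter Γ Λ → Option (QState Γ Λ × List (QLetter Γ Λ))
  | .inl o, some (x, none) => some (.inl (some x), o.toList.map symLetter)
  | .inl o, some (a, some q) => (M q a).map fun p => match p.2 with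
    | .move .left => (.inr none, [some (o.getD default, some p.1), symLetter a])
    | .move .right => (.inr (some p.1), o.toList.map symLetter ++ [symLetter a])
    | .write b => (.inr none, o.toList.map symLetter ++ [some (b, some p.1)])
  | .inl _, none => none
  | .inr (some q), some (x, none) => some (.inr none, [some (x, some q)])
  | .inr (some q), none => some (.inl none, [some (default, some q), none])
  | .inr none, some (x, none) => some (.inr none, [symLetter x])
  | .inr none, none => some (.inl none, [none])
  | .inr _, some (_, some _) => none

/-- The code of a configuration. -/
def cfgCode : TapeCfg Γ Λ → List (QLetter Γ Λ)
  | (q, a, L, R) => L.reverse.map symLetter ++ some (a, some q) :: (R.map symLetter ++ [none])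
end Tape

section TapeLemmas
variable {Γ Λ : Type} [Inhabited Γ] (M : Λ → Γ → Option (Λ × TM0.Stmt Γ))

theorem length_le_two_of_queueStep {s s' : QState Γ Λ} {x : QLetter Γ Λ} {w : List (QLetter Γ Λ)}
    (h : queueStep M s x = some (s', w)) : w.length ≤ 2 := by
  have ho (o : Option Γ) : (o.toList.map (symLetter (Λ := Λ))).length ≤ 1 := by cases o <;> simp
  rcases s with o | _ | q <;> rcases x with _ | ⟨a, _ | q'⟩ <;>
    simp only [queueStep, Option.some.injEq, Prod.mk.injEq, reduceCtorEq, Option.map_eq_some_iff]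
      at h
  case inl.some.some =>
    obtain ⟨⟨q, d | d⟩, -, h⟩ := h
    · cases d
      · cases h; simp
      · cases h; have := ho o; simp only [List.length_append, List.length_singleton]; omega
    · cases h; have := ho o; simp only [List.length_append, List.length_singleton]; omega
  all_goals
    obtain ⟨-, rfl⟩ := h
    first | simp; done | exact (ho o).trans one_le_two

theorem gsmRun_scan (o : Option Γ) (u : List Γ) (l : Γ) :
    gsmRun (queueStep M) (.inl o) ((u ++ [l]).map symLetter) =
      some (.inl (some l), (o.toList ++ u).map symLetter) := by
  have step (o : Option Γ) (x : Γ) : queueStep M (.inl o) (symLetter x) =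
    some (.inl (some x), o.toList.map symLetter) := rfl
  induction u generalizing o with
  | nil => simp [gsmRun, step]
  | cons a u ih =>
    rw [List.cons_append, List.map_cons, gsmRun, step, Option.bind_some, ih]
    simp

theorem gsmRun_pass (R : List Γ) :
    gsmRun (queueStep M) (.inr none) (R.map symLetter ++ [none]) =
      some (.inl none, R.map symLetter ++ [none]) := by
  have step (x : Γ) : queueStep M (.inr none) (symLetter x) = some (.inr none, [symLetter x]) := rfl
  induction R with
  | nil => simp [gsmRun, queueStep]
  | cons a R ih => simp [gsmRun, step, ih]

theorem gsmRun_carry (q : Λ) (R : List Γ) :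
    gsmRun (queueStep M) (.inr (some q)) (R.map symLetter ++ [none]) =
      some (.inl none, some (R.headI, some q) :: (R.tail.map symLetter ++ [none])) := by
  have step (x : Γ) : queueStep M (.inr (some q)) (symLetter x) =
    some (.inr none, [some (x, some q)]) := rfl
  cases R with
  | nil => simp [gsmRun, queueStep]
  | cons a R => simp [gsmRun, step, gsmRun_pass]

theorem gsmRun_cfgCode (c : TapeCfg Γ Λ) :
    gsmRun (queueStep M) (.inl none) (cfgCode c) =
      (tapeStep M c).map fun c' => (.inl none, cfgCode c') := by
  obtain ⟨q, a, L, R⟩ := c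
  have key (o : Option Γ) (u : List (QLetter Γ Λ)) (L' : List Γ)
      (hu : gsmRun (queueStep M) (.inl none) u = some (.inl o, L'.reverse.map symLetter))
      (hL : L = o.toList ++ L') (hL' : o = none → L' = []) :
      gsmRun (queueStep M) (.inl none) (u ++ some (a, some q) :: (R.map symLetter ++ [none])) =
      (tapeStep M (q, a, L, R)).map fun c' => (.inl none, cfgCode c') := by
    rw [gsmRun_append_of_eq_some _ hu, gsmRun]
    simp only [queueStep, tapeStep]
    cases M q a with
    | none => rfl
    | some p =>
      obtain ⟨q', d | b⟩ := p
      · cases d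
        · have h := gsmRun_pass M R
          cases o with
          | none => simp [h, cfgCode, hL, hL' rfl]
          | some l => simp [h, cfgCode, hL]
        · have h := gsmRun_carry M q' R
          cases o <;> simp [h, cfgCode, hL]
      · have h := gsmRun_pass M R
        cases o <;> simp [h, cfgCode, hL]
  cases L with
  | nil => exact key none [] [] rfl rfl fun _ => rfl
  | cons l L =>
    refine key (some l) _ L ?_ rfl nofun
    rw [List.reverse_cons]
    exact gsmRun_scan M none _ l

end TapeLemmas

section Iterate
variable {σ τ : Type}

theorem eval_dom_iff_exists_iterate_eq_none (f : σ → Option σ) (a : σ) :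
    (StateTransition.eval f a).Dom ↔ ∃ i, (fun o => o.bind f)^[i] (some a) = none := by
  rw [Part.dom_iff_mem]
  simp only [StateTransition.mem_eval]
  constructor
  · rintro ⟨b, hab, hb⟩
    induction hab using Relation.ReflTransGen.head_induction_on with
    | refl => exact ⟨1, hb⟩
    | head h _ ih =>
      obtain ⟨i, hi⟩ := ih
      exact ⟨i + 1, by rw [Function.iterate_succ_apply, Option.bind_some, Option.mem_def.1 h, hi]⟩
  · rintro ⟨i, hi⟩
    induction i generalizing a with
    | zero => simp at hi
    | succ i ih =>
      rw [Function.iterate_succ_apply, Option.bind_some] at hi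
      cases h : f a with
      | none => exact ⟨a, .refl, h⟩
      | some c =>
        obtain ⟨b, hcb, hb⟩ := ih c (h ▸ hi)
        exact ⟨b, hcb.head h, hb⟩

theorem gsmRun_map {α β : Type} {δ : σ → α → Option (σ × List α)} {δ' : τ → β → Option (τ × List β)}
    {f : σ → τ} {g : α → β} (h : ∀ q a, δ' (f q) (g a) = (δ q a).map (Prod.map f (List.map g)))
    (q : σ) (u : List α) :
    gsmRun δ' (f q) (u.map g) = (gsmRun δ q u).map (Prod.map f (List.map g)) := by
  induction u generalizing q with
  | nil => rfl
  | cons a u ih =>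
    rw [List.map_cons, gsmRun, gsmRun, h]
    cases δ q a with
    | none => rfl
    | some p =>
      simp only [Option.map_some, Option.bind_some, Prod.map, ih]
      cases gsmRun δ p.1 u <;> simp

end Iterate

section TM0
variable {Γ Λ : Type} [Inhabited Γ] [Inhabited Λ] {M : TM0.Machine Γ Λ} {S : Set Λ}

/-- A machine restricted to a set of states that supports it. -/
def restrictMachine (hS : TM0.Supports M S) (q : S) (a : Γ) : Option (S × TM0.Stmt Γ) :=
  (M q a).pmap (fun p hp => (⟨p.1, hp⟩, p.2)) fun _ hp => hS.2 hp q.2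

/-- The machine configuration represented by an explicit one. -/
def TapeCfg.toCfg (c : TapeCfg Γ S) : TM0.Cfg Γ Λ :=
  ⟨c.1, ⟨c.2.1, ListBlank.mk c.2.2.1, ListBlank.mk c.2.2.2⟩⟩

theorem step_toCfg (hS : TM0.Supports M S) (c : TapeCfg Γ S) :
    TM0.step M c.toCfg = (tapeStep (restrictMachine hS) c).map TapeCfg.toCfg := by
  obtain ⟨q, a, L, R⟩ := c
  simp only [TapeCfg.toCfg, TM0.step, tapeStep, restrictMachine]
  generalize_proofs h
  revert h
  cases M q a with
  | none => intro _; rfl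
  | some p =>
    intro _
    obtain ⟨q', (_ | _) | b⟩ := p <;> rfl

theorem iterate_toCfg (hS : TM0.Supports M S) (i : ℕ) (o : Option (TapeCfg Γ S)) :
    (fun o => o.bind (TM0.step M))^[i] (o.map TapeCfg.toCfg) =
      ((fun o => o.bind (tapeStep (restrictMachine hS)))^[i] o).map TapeCfg.toCfg := by
  have : Function.Semiconj (Option.map TapeCfg.toCfg)
      (fun o => o.bind (tapeStep (restrictMachine hS))) (fun o => o.bind (TM0.step M)) := by
    rintro (_ | c)
    · rfl
    · exact (step_toCfg hS c).symm
  exact ((this.iterate_right i) o).symm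

end TM0

/-- A sequential transducer transported to `ℕ`, with an additional state `0` that copies. -/
def natStep {σ α : Type} [Encodable σ] [Encodable α] (δ : σ → α → Option (σ × List α)) :
    ℕ → ℕ → Option (ℕ × List ℕ)
  | 0, a => some (0, [a])
  | q + 1, a => (Encodable.decode (α := σ) q).bind fun q => (Encodable.decode (α := α) a).bind fun a =>
      (δ q a).map (Prod.map (fun q => Encodable.encode q + 1) (List.map Encodable.encode))

/-- The initial word for the input `n`. -/
def initWord (h b x e n : ℕ) : List ℕ :=
  h :: b :: (List.replicate n x ++ [e])

theorem exists_queueMachine :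
    ∃ (Q A : Finset ℕ) (δ : ℕ → ℕ → Option (ℕ × List ℕ)) (s r h b x e : ℕ)
      (conf : ℕ → ℕ → Option (List ℕ)),
      s ∈ Q ∧ r ∈ Q ∧ (∀ a, δ r a = some (r, [a])) ∧
      (∀ q ∈ Q, ∀ a ∈ A, ∀ p ∈ δ q a, p.1 ∈ Q ∧ p.2.length ≤ 2 ∧ ∀ y ∈ p.2, y ∈ A) ∧
      ∀ n, conf n 0 = some (initWord h b x e n) ∧
        (∀ i, ∀ u ∈ conf n i, u ≠ [] ∧ (∀ y ∈ u, y ∈ A) ∧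
          gsmRun δ s u = (conf n (i + 1)).map fun v => (s, v)) ∧
        ((∃ i, conf n i = none) ↔
          (Nat.Partrec.Code.eval (Denumerable.ofNat Nat.Partrec.Code n) 0).Dom) := by
  obtain ⟨Γ, Λ, _, _, hΓ, M, S, a, b, x, hfin, hS, hM⟩ := exists_TM0
  have : Finite S := hfin
  have : Fintype (QState Γ S) := Fintype.ofFinite _
  have : Fintype (QLetter Γ S) := Fintype.ofFinite _
  have : Encodable (QState Γ S) := Encodable.ofCountable _
  have : Encodable (QLetter Γ S) := Encodable.ofCountable _
  let code (u : List (QLetter Γ S)) : List ℕ := u.map Encodable.encode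
  let q₀ : S := ⟨default, hS.1⟩
  let start (n : ℕ) : TapeCfg Γ S := (q₀, a, [], b :: List.replicate n x)
  let conf (n i : ℕ) : Option (TapeCfg Γ S) :=
    (fun o => o.bind (tapeStep (restrictMachine hS)))^[i] (some (start n))
  let st (q : QState Γ S) : ℕ := Encodable.encode q + 1
  let δ := natStep (queueStep (restrictMachine hS))
  have hδ (q : QState Γ S) (y : QLetter Γ S) : δ (st q) (Encodable.encode y) =
      (queueStep (restrictMachine hS) q y).map (Prod.map st (List.map Encodable.encode)) := by
    simp [δ, st, natStep]
  refine ⟨insert 0 (Finset.univ.image st), Finset.univ.image fun y : QLetter Γ S => Encodable.encode y,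
    δ, st (.inl none), 0,
    Encodable.encode (some (a, some q₀) : QLetter Γ S),
    Encodable.encode (symLetter b : QLetter Γ S), Encodable.encode (symLetter x : QLetter Γ S),
    Encodable.encode (none : QLetter Γ S), fun n i => (conf n i).map fun c => code (cfgCode c),
    by simp, by simp, fun a => rfl, ?_, fun n => ⟨?_, ?_, ?_⟩⟩
  · intro q hq y hy p hp
    obtain ⟨y, -, rfl⟩ := Finset.mem_image.1 hy
    rcases Finset.mem_insert.1 hq with rfl | hq
    · cases hp
      simp
    · obtain ⟨q, -, rfl⟩ := Finset.mem_image.1 hq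
      rw [hδ, Option.mem_def, Option.map_eq_some_iff] at hp
      obtain ⟨⟨q', w⟩, hw, rfl⟩ := hp
      have := length_le_two_of_queueStep _ hw
      simp [this]
  · simp [conf, start, code, cfgCode, initWord]
  · intro i u hu
    obtain ⟨c, hc, rfl⟩ := Option.mem_map.1 hu
    refine ⟨by simp [code, cfgCode], fun y hy => ?_, ?_⟩
    · obtain ⟨z, -, rfl⟩ := List.mem_map.1 hy
      simp
    · have : conf n (i + 1) = tapeStep (restrictMachine hS) c := by
        simp only [conf, Function.iterate_succ_apply']
        exact congrArg (fun o : Option _ => o.bind _) hc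
      dsimp only
      rw [gsmRun_map hδ, gsmRun_cfgCode, this, Option.map_map, Option.map_map]
      rfl
  · rw [← hM n]
    have hinit : TM0.init (a :: b :: List.replicate n x) = (start n).toCfg (Λ := Λ) := rfl
    simp only [Option.map_eq_none_iff]
    change _ ↔ (StateTransition.eval (TM0.step M) (TM0.init _)).Dom
    rw [eval_dom_iff_exists_iterate_eq_none, hinit]
    refine exists_congr fun i => ?_
    have := iterate_toCfg hS i (some (start n))
    rw [Option.map_some] at this
    rw [this, Option.map_eq_none_iff]

end QueueMachine

/-- `OriginPath P F c q u v os`: with `c` input letters already consumed, transitions satisfying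
`P` lead from state `q` to a state satisfying `F` while reading `u` and producing `v`, whose
positions have the origins `os`. -/
inductive OriginPath (P : NTrans → Prop) (F : ℕ → Prop) :
    ℕ → ℕ → List ℕ → List ℕ → List ℕ → Prop
  | nil {c q : ℕ} (h : F q) : OriginPath P F c q [] [] []
  | read {c q a q' : ℕ} {w u v os : List ℕ} (ht : P (q, some a, w, q'))
      (h : OriginPath P F (c + 1) q' u v os) :
      OriginPath P F c q (a :: u) (w ++ v) (List.replicate w.length (c + 1) ++ os)
  | eps {c q q' : ℕ} {w u v os : List ℕ} (ht : P (q, none, w, q'))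
      (h : OriginPath P F c q' u v os) :
      OriginPath P F c q u (w ++ v) (List.replicate w.length (max c 1) ++ os)

namespace OriginPath
variable {P P' : NTrans → Prop} {F : ℕ → Prop} {c q : ℕ} {u v os : List ℕ}

theorem mono (hP : ∀ t, P t → P' t) (h : OriginPath P F c q u v os) :
    OriginPath P' F c q u v os := by
  induction h with
  | nil h => exact .nil h
  | read ht _ ih => exact .read (hP _ ht) ih
  | eps ht _ ih => exact .eps (hP _ ht) ih

theorem length_eq (h : OriginPath P F c q u v os) : os.length = v.length := by
  induction h with
  | nil h => rfl
  | read _ _ ih | eps _ _ ih => simp [ih]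

theorem origin_mem (h : OriginPath P F c q u v os) :
    ∀ x ∈ os, 1 ≤ x ∧ x ≤ max (c + u.length) 1 := by
  induction h with
  | nil h => simp
  | read _ _ ih | eps _ _ ih =>
    intro x hx
    rcases List.mem_append.1 hx with hx | hx
    · obtain rfl := List.eq_of_mem_replicate hx
      grind
    · grind

theorem iff_exists_run (P : NTrans → Prop) (F : ℕ → Prop) (c q : ℕ) (u v os : List ℕ) :
    OriginPath P F c q u v os ↔ ∃ ts : List NTrans, (∀ t ∈ ts, P t) ∧
      (ts.head?.elim True fun t => t.1 = q) ∧
      (ts.getLast?.elim (F q) fun t => F t.2.2.2) ∧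
      ts.IsChain (fun s t => s.2.2.2 = t.1) ∧ runData c ts = (u, v, os) := by
  constructor
  · intro h
    induction h with
    | nil h => exact ⟨[], nofun, trivial, h, .nil, rfl⟩
    | read ht _ ih | eps ht _ ih =>
      obtain ⟨ts, h1, h2, h3, h4, h5⟩ := ih
      refine ⟨_ :: ts, List.forall_mem_cons.2 ⟨ht, h1⟩, rfl, ?_, ?_, by simp [runData, h5]⟩
      · cases ts with
        | nil => exact h3
        | cons t ts => rwa [List.getLast?_cons_cons, List.getLast?_eq_getLast_of_ne_nil (by simp)] at *
      · cases ts with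
        | nil => simp
        | cons t ts => exact List.isChain_cons_cons.2 ⟨h2.symm, h4⟩
  · rintro ⟨ts, h1, h2, h3, h4, h5⟩
    induction ts generalizing c q u v os with
    | nil =>
      obtain ⟨rfl, rfl, rfl⟩ : [] = u ∧ [] = v ∧ [] = os := by simpa [runData] using h5
      exact .nil h3
    | cons t ts ih =>
      obtain ⟨q₀, i, w, q'⟩ := t
      obtain rfl : q₀ = q := h2
      have hP := h1 _ List.mem_cons_self
      have key (d : ℕ) : OriginPath P F d q' (runData d ts).1 (runData d ts).2.1
          (runData d ts).2.2 := by
        refine ih d q' _ _ _ (fun t ht => h1 t (List.mem_cons_of_mem _ ht)) ?_ ?_ ?_ rfl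
        · cases ts with
          | nil => trivial
          | cons t ts => exact (List.isChain_cons_cons.1 h4).1.symm
        · cases ts with
          | nil => exact h3
          | cons t ts => rwa [List.getLast?_cons_cons, List.getLast?_eq_getLast_of_ne_nil (by simp)] at *
        · exact h4.tail
      cases i with
      | none =>
        obtain ⟨rfl, rfl, rfl⟩ := by simpa [runData] using h5
        exact .eps hP (key c)
      | some a =>
        obtain ⟨rfl, rfl, rfl⟩ := by simpa [runData] using h5
        exact .read hP (key (c + 1))

end OriginPath

theorem mem_OSem_iff (T : NT1) (g : OriginGraph ℕ ℕ) :
    g ∈ OSem T ↔ ∃ q ∈ T.2.1, ∃ os,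
      OriginPath (· ∈ T.1) (· ∈ T.2.2) 0 q g.inp g.out os ∧
      ∀ z, 1 ≤ z → z ≤ g.out.length → g.orig z = os.getD (z - 1) 1 := by
  simp only [OriginPath.iff_exists_run]
  constructor
  · rintro ⟨ts, ⟨hne, h1, h2, h3, h4⟩, hu, hv, ho⟩
    obtain ⟨t, ts, rfl⟩ := List.exists_cons_of_ne_nil hne
    refine ⟨t.1, h2, _, ⟨t :: ts, h1, rfl, ?_, h4, by rw [hu, hv]⟩, ho⟩
    rw [List.getLast?_eq_getLast_of_ne_nil hne] at h3 ⊢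
    exact h3
  · rintro ⟨q, hq, os, ⟨ts, h1, h2, h3, h4, h5⟩, ho⟩
    have hne : ts ≠ [] := by
      rintro rfl
      exact g.inp_ne (congrArg Prod.fst h5).symm
    obtain ⟨t, ts, rfl⟩ := List.exists_cons_of_ne_nil hne
    obtain rfl : t.1 = q := h2
    refine ⟨t :: ts, ⟨hne, h1, hq, ?_, h4⟩, by rw [h5], by rw [h5], by rwa [h5]⟩
    rw [List.getLast?_eq_getLast_of_ne_nil hne] at h3 ⊢
    exact h3

section Check
variable (Q A : Finset ℕ) (δ : ℕ → ℕ → Option (ℕ × List ℕ))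

/-- Transitions checking that the output deviates from the output of the sequential transducer
`δ` on the input. State `q + 4` tracks the state `q` of `δ`; in state `1` the remaining input and
output are unconstrained, in state `2` only output remains, in state `3` only input remains. -/
inductive CheckTrans : NTrans → Prop
  | dumpRead {a : ℕ} (ha : a ∈ A) : CheckTrans (1, some a, [], 1)
  | dumpEmit {a : ℕ} (ha : a ∈ A) : CheckTrans (1, none, [a], 1)
  | emit {a : ℕ} (ha : a ∈ A) : CheckTrans (2, none, [a], 2)
  | read {a : ℕ} (ha : a ∈ A) : CheckTrans (3, some a, [], 3)
  | toEmit {q a : ℕ} (hq : q ∈ Q) (ha : a ∈ A) : CheckTrans (q + 4, none, [a], 2)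
  | stuck {q a : ℕ} (hq : q ∈ Q) (ha : a ∈ A) (h : δ q a = none) :
      CheckTrans (q + 4, some a, [], 1)
  | follow {q a q' : ℕ} {w : List ℕ} (hq : q ∈ Q) (ha : a ∈ A) (h : δ q a = some (q', w)) :
      CheckTrans (q + 4, some a, w, q' + 4)
  | differ {q a q' : ℕ} {w w' : List ℕ} (hq : q ∈ Q) (ha : a ∈ A) (h : δ q a = some (q', w))
      (hw' : ∀ y ∈ w', y ∈ A) (hne : w' ≠ w) (hlen : w'.length = w.length) :
      CheckTrans (q + 4, some a, w', 1)
  | short {q a q' : ℕ} {w w' : List ℕ} (hq : q ∈ Q) (ha : a ∈ A) (h : δ q a = some (q', w))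
      (hw' : ∀ y ∈ w', y ∈ A) (hlen : w'.length < w.length) :
      CheckTrans (q + 4, some a, w', 3)

/-- `δ` has states `Q`, letters `A`, and produces at most two letters at a time. -/
def IsQueueStep : Prop :=
  ∀ q ∈ Q, ∀ a ∈ A, ∀ p ∈ δ q a, p.1 ∈ Q ∧ p.2.length ≤ 2 ∧ ∀ y ∈ p.2, y ∈ A

variable {Q A δ}

theorem finite_checkTrans (hδ : IsQueueStep Q A δ) : {t | CheckTrans Q A δ t}.Finite := by
  let W : Set (List ℕ) := {w | w.length ≤ 2 ∧ ∀ y ∈ w, y ∈ A}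
  have hW : W.Finite := by
    have : {l : List A | l.length ≤ 2}.Finite := List.finite_length_le A 2
    refine (this.image (List.map Subtype.val)).subset ?_
    rintro w ⟨h1, h2⟩
    lift w to List A using h2
    exact ⟨w, by simpa using h1, rfl⟩
  let St : Finset ℕ := {1, 2, 3} ∪ Q.image (· + 4)
  have hSt (q : ℕ) (hq : q ∈ Q) : q + 4 ∈ St := by
    simp [St, hq]
  have hfin := St.finite_toSet.prod ((insert none (A.image some)).finite_toSet.prod
    (hW.prod St.finite_toSet))
  refine hfin.subset ?_
  intro t ht
  cases ht with
  | dumpRead ha | dumpEmit ha | emit ha | read ha => simp [St, W, ha]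
  | toEmit hq ha | stuck hq ha h => simp [St, W, ha, hq]
  | follow hq ha h =>
    have := hδ _ hq _ ha _ h
    exact ⟨hSt _ hq, by simp [ha], this.2, hSt _ this.1⟩
  | differ hq ha h hw' hne hlen =>
    have := hδ _ hq _ ha _ h
    exact ⟨hSt _ hq, by simp [ha], ⟨hlen.trans_le this.2.1, hw'⟩, by simp [St]⟩
  | short hq ha h hw' hlen =>
    have := hδ _ hq _ ha _ h
    exact ⟨hSt _ hq, by simp [ha], ⟨hlen.le.trans this.2.1, hw'⟩, by simp [St]⟩

section Existence
variable {F : ℕ → Prop} {u v : List ℕ}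

theorem exists_path_read (hu : ∀ a ∈ u, a ∈ A) {q : ℕ} (hq : q = 1 ∨ q = 3) (hF : F q) (c : ℕ) :
    OriginPath (CheckTrans Q A δ) F c q u [] [] := by
  induction u generalizing c with
  | nil => exact .nil hF
  | cons a u ih =>
    have := ih (fun b hb => hu b (List.mem_cons_of_mem _ hb)) (c + 1)
    have ha := hu a List.mem_cons_self
    rcases hq with rfl | rfl
    · exact .read (.dumpRead ha) this
    · exact .read (.read ha) this

theorem exists_path_emit {q : ℕ} (hv : ∀ a ∈ v, a ∈ A) (hq : q = 1 ∨ q = 2) {c : ℕ} {os : List ℕ}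
    (h : OriginPath (CheckTrans Q A δ) F c q u [] os) :
    OriginPath (CheckTrans Q A δ) F c q u v (List.replicate v.length (max c 1) ++ os) := by
  induction v with
  | nil => exact h
  | cons a v ih =>
    have := ih fun b hb => hv b (List.mem_cons_of_mem _ hb)
    have ha := hv a List.mem_cons_self
    rcases hq with rfl | rfl
    · exact .eps (.dumpEmit ha) this
    · exact .eps (.emit ha) this

theorem exists_path_dump (hu : ∀ a ∈ u, a ∈ A) (hv : ∀ a ∈ v, a ∈ A) (hF : F 1) (c : ℕ) :
    OriginPath (CheckTrans Q A δ) F c 1 u v (List.replicate v.length (max c 1)) := by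
  simpa using exists_path_emit hv (.inl rfl) (exists_path_read (δ := δ) (Q := Q) hu (.inl rfl) hF c)

/-- If the output does not extend the output of `δ` on the first `K` letters of the input, this is
detected within the first `K` letters. -/
theorem exists_path_of_not_isPrefix (hδ : IsQueueStep Q A δ) (h1 : F 1) (h2 : F 2) (h3 : F 3)
    (hQ : ∀ q ∈ Q, F (q + 4)) (hu : ∀ a ∈ u, a ∈ A) (hv : ∀ a ∈ v, a ∈ A) {q : ℕ} (hq : q ∈ Q)
    (c K : ℕ) (h : u.length ≤ K ∨ ¬ ∃ q' o, gsmRun δ q (u.take K) = some (q', o) ∧ o <+: v) :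
    ∃ os, OriginPath (CheckTrans Q A δ) F c (q + 4) u v os ∧ ∀ x ∈ os, x ≤ max (c + K) 1 := by
  induction u generalizing v q c K with
  | nil =>
    cases v with
    | nil => exact ⟨_, .nil (hQ _ hq), by simp⟩
    | cons a v =>
      have ha := hv a List.mem_cons_self
      have : OriginPath (CheckTrans Q A δ) F c 2 [] v _ :=
        exists_path_emit (fun b hb => hv b (List.mem_cons_of_mem _ hb)) (.inr rfl) (.nil h2)
      refine ⟨_, .eps (.toEmit hq ha) this, ?_⟩
      simp only [List.length_singleton, List.replicate_one, List.singleton_append, List.append_nil,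
        List.mem_cons, List.mem_replicate]
      omega
  | cons a u ih =>
    have ha := hu a List.mem_cons_self
    have hu' : ∀ b ∈ u, b ∈ A := fun b hb => hu b (List.mem_cons_of_mem _ hb)
    cases K with
    | zero => simp [gsmRun] at h
    | succ K =>
      cases hstep : δ q a with
      | none =>
        refine ⟨_, .read (.stuck hq ha hstep) (exists_path_dump hu' hv h1 (c + 1)), ?_⟩
        intro x hx
        simp only [List.length_nil, List.replicate_zero, List.nil_append, List.mem_replicate] at hx
        omega
      | some p =>
        obtain ⟨q', w⟩ := p
        obtain ⟨hq', hwlen, hwA⟩ := hδ _ hq _ ha _ hstep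
        by_cases hwv : w <+: v
        · obtain ⟨v, rfl⟩ := hwv
          obtain ⟨os, hos, hle⟩ := ih hu' (fun b hb => hv b (List.mem_append_right _ hb)) hq'
            (c + 1) K (by
              refine h.imp (by simp) (mt ?_)
              rintro ⟨r, o, hr, ho⟩
              refine ⟨r, w ++ o, ?_, (List.prefix_append_right_inj w).2 ho⟩
              simp [gsmRun, hstep, hr])
          refine ⟨_, .read (.follow hq ha hstep) hos, ?_⟩
          intro x hx
          rcases List.mem_append.1 hx with hx | hx
          · have := List.eq_of_mem_replicate hx
            omega
          · have := hle x hx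
            omega
        · rcases lt_or_ge v.length w.length with hlt | hge
          · have := OriginPath.read (.short hq ha hstep hv hlt)
              (exists_path_read (δ := δ) (Q := Q) hu' (.inr rfl) h3 (c + 1))
            rw [List.append_nil, List.append_nil] at this
            refine ⟨_, this, fun x hx => ?_⟩
            have := List.eq_of_mem_replicate hx
            omega
          · have hlen : (v.take w.length).length = w.length := by simpa using hge
            have := OriginPath.read (.differ hq ha hstep
              (fun y hy => hv y (List.mem_of_mem_take hy))
              (fun he => hwv (he ▸ List.take_prefix _ _)) hlen)
              (exists_path_dump (v := v.drop w.length) (δ := δ) (Q := Q) hu'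
                (fun y hy => hv y (List.mem_of_mem_drop hy)) h1 (c + 1))
            rw [List.take_append_drop] at this
            refine ⟨_, this, fun x hx => ?_⟩
            simp only [List.mem_append, List.mem_replicate] at hx
            omega

end Existence

section Bound
variable {F : ℕ → Prop} {c q : ℕ} {u v os : List ℕ}

theorem input_eq_nil_of_emit (h : OriginPath (CheckTrans Q A δ) F c 2 u v os) : u = [] := by
  generalize hs : 2 = s at h
  induction h with
  | nil => rfl
  | read ht => subst hs; cases ht
  | eps ht _ ih => subst hs; cases ht; exact ih rfl

theorem origins_eq_nil_of_read (h : OriginPath (CheckTrans Q A δ) F c 3 u v os) : os = [] := by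
  generalize hs : 3 = s at h
  induction h with
  | nil => rfl
  | read ht _ ih => subst hs; cases ht; exact ih rfl
  | eps ht => subst hs; cases ht

theorem mem_letters_of_dump (h : OriginPath (CheckTrans Q A δ) F c 1 u v os) :
    (∀ a ∈ u, a ∈ A) ∧ ∀ a ∈ v, a ∈ A := by
  generalize hs : 1 = s at h
  induction h with
  | nil => simp
  | read ht _ ih => subst hs; cases ht with | dumpRead ha => simpa [ha] using ih rfl
  | eps ht _ ih => subst hs; cases ht with | dumpEmit ha => simpa [ha] using ih rfl

/-- If no deviation from the output of `δ` occurs, then every origin is used at most twice. -/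
theorem length_le_of_isPrefix (hδ : IsQueueStep Q A δ)
    (h : OriginPath (CheckTrans Q A δ) F c (q + 4) u v os) {q' : ℕ} {o : List ℕ}
    (hrun : gsmRun δ q u = some (q', o)) (hv : v <+: o) :
    (∀ x ∈ os, c < x) ∧ os.length ≤ 2 * os.toFinset.card := by
  generalize hs : q + 4 = s at h
  induction h generalizing q o with
  | nil => simp
  | @read c _ a _ w u v os ht h ih =>
    subst hs
    rw [gsmRun] at hrun
    cases ht with
    | stuck _ _ hstep => simp [hstep] at hrun
    | @follow _ _ r _ hq ha hstep =>
      simp only [hstep, Option.bind_some, Option.map_eq_some_iff, Prod.mk.injEq] at hrun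
      obtain ⟨⟨_, o⟩, hrun, rfl, rfl⟩ := hrun
      obtain ⟨hlt, hle⟩ := ih hrun ((List.prefix_append_right_inj w).1 hv) rfl
      have hw := (hδ _ hq _ ha _ hstep).2.1
      refine ⟨fun x hx => ?_, ?_⟩
      · rcases List.mem_append.1 hx with hx | hx
        · exact (List.eq_of_mem_replicate hx).symm ▸ c.lt_succ_self
        · exact c.lt_succ_self.trans (hlt x hx)
      · have hnot : c + 1 ∉ os.toFinset := fun hx => (hlt _ (List.mem_toFinset.1 hx)).false
        rcases eq_or_ne w [] with rfl | hne
        · simpa using hle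
        · rw [List.toFinset_append, List.toFinset_replicate_of_ne_zero (by simpa using hne),
            Finset.card_union_of_disjoint (by simpa using hnot), Finset.card_singleton]
          simp only [List.length_append, List.length_replicate]
          dsimp only at hw
          omega
    | @differ _ _ r w₀ _ hq ha hstep hw' hne hlen =>
      simp only [hstep, Option.bind_some, Option.map_eq_some_iff, Prod.mk.injEq] at hrun
      obtain ⟨⟨_, o⟩, -, rfl, rfl⟩ := hrun
      exact absurd ((List.prefix_of_prefix_length_le ((List.prefix_append w v).trans hv)
        (List.prefix_append w₀ _) hlen.le).eq_of_length hlen) hne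
    | short hq ha hstep hw' hlen =>
      have hw := (hδ _ hq _ ha _ hstep).2.1
      dsimp only at hw
      rw [origins_eq_nil_of_read h, List.append_nil]
      refine ⟨fun x hx => (List.eq_of_mem_replicate hx).symm ▸ c.lt_succ_self, ?_⟩
      rcases eq_or_ne w [] with rfl | hne
      · simp
      · rw [List.toFinset_replicate_of_ne_zero (by simpa using hne)]
        simp only [List.length_replicate, Finset.card_singleton]
        omega
  | eps ht h =>
    subst hs
    cases ht
    obtain rfl := input_eq_nil_of_emit h
    cases hrun
    simp at hv

end Bound
end Check

section Markers
variable {Sig : Type} {m : ℕ}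

/-- The resynchronizer language that requires the source position to be among the first `K`
positions. -/
def sourceWithin (Sig : Type) (m K : ℕ) : Set (List (RLetter Sig m)) :=
  {w | (w.take K).any (·.2.2.1)}

theorem isRegularLang_sourceWithin (K : ℕ) : IsRegularLang (sourceWithin Sig m K) := by
  let M : DFA (RLetter Sig m) (Fin (K + 1) × Bool) :=
    { step s a := (⟨min (s.1 + 1) K, by omega⟩, s.2 || (decide (s.1.val < K) && a.2.2.1))
      start := (0, false)
      accept := {s | s.2} }
  have key (w : List (RLetter Sig m)) :
      (M.eval w).1.val = min w.length K ∧ (M.eval w).2 = (w.take K).any (·.2.2.1) := by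
    induction w using List.reverseRecOn with
    | nil => simp [M]
    | append_singleton w a ih =>
      rw [DFA.eval_append_singleton]
      simp only [M] at ih ⊢
      refine ⟨by rw [ih.1, List.length_append, List.length_singleton]; omega, ?_⟩
      rw [ih.1, ih.2, List.take_append, List.any_append]
      rcases lt_or_ge w.length K with h | h
      · obtain ⟨d, hd⟩ : ∃ d, K - w.length = d + 1 := ⟨K - w.length - 1, by omega⟩
        simp [h, hd, min_eq_left h.le]
      · simp [h]
  refine ⟨_, inferInstance, M, Set.ext fun w => ?_⟩
  change (M.eval w).2 = true ↔ _
  rw [(key w).2]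
  rfl

theorem rSat_sourceWithin_iff {K : ℕ} {u : List Sig} {I : Fin m → ℕ → Bool} {x y : ℕ} :
    RSat (sourceWithin Sig m K) u I x y ↔ 1 ≤ x ∧ x ≤ u.length ∧ x ≤ K := by
  change ((annot u I x y).take K).any _ = true ↔ _
  simp only [List.any_eq_true, List.mem_take_iff_getElem, annot, List.getElem_mapIdx,
    List.length_mapIdx]
  constructor
  · rintro ⟨_, ⟨i, hi, rfl⟩, h⟩
    have : i + 1 = x := by simpa using h
    omega
  · rintro ⟨h1, h2, h3⟩
    exact ⟨_, ⟨x - 1, by omega, rfl⟩, by simp; omega⟩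

theorem boundedResync_sourceWithin (K : ℕ) : BoundedResync (sourceWithin Sig m K) := by
  refine ⟨K, fun u I y _ _ => ?_⟩
  have : {x : ℕ | 1 ≤ x ∧ x ≤ u.length ∧ RSat (sourceWithin Sig m K) u I x y} ⊆
      (Finset.Icc 1 K : Finset ℕ) := by
    rintro x ⟨h1, -, hx⟩
    simpa [h1] using (rSat_sourceWithin_iff.1 hx).2.2
  calc _ ≤ (↑(Finset.Icc 1 K) : Set ℕ).ncard := Set.ncard_le_ncard this (Finset.finite_toSet _)
    _ = K := by rw [Set.ncard_coe_finset]; simp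

end Markers

theorem OriginPath.exists_mem_OSem {T : NT1} {q : ℕ} (hq : q ∈ T.2.1) {u v os : List ℕ}
    (h : OriginPath (· ∈ T.1) (· ∈ T.2.2) 0 q u v os) (hu : u ≠ []) :
    ∃ g ∈ OSem T, g.inp = u ∧ g.out = v ∧ ∀ z, 1 ≤ z → z ≤ v.length → g.orig z ∈ os := by
  have key : ∀ z, 1 ≤ z → z ≤ v.length → os.getD (z - 1) 1 ∈ os := by
    intro z h1 h2
    have hz : z - 1 < os.length := by rw [h.length_eq]; omega
    rw [List.getD_eq_getElem _ _ hz]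
    exact List.getElem_mem hz
  have hpos : 1 ≤ u.length := List.length_pos_iff.2 hu
  refine ⟨⟨u, v, fun z => os.getD (z - 1) 1, hu, fun z h1 h2 => ?_⟩,
    (mem_OSem_iff _ _).2 ⟨q, hq, os, h, fun z _ _ => rfl⟩, rfl, rfl, key⟩
  have := h.origin_mem _ (key z h1 h2)
  omega

section Prefixed
variable {Q A : Finset ℕ} {δ : ℕ → ℕ → Option (ℕ × List ℕ)} {L : List NTrans} {F : ℕ → Prop}
  {c q : ℕ} {w u v os : List ℕ}

theorem path_of_path_cons (hL : ∀ t, t ∈ L ↔ CheckTrans Q A δ t) {p : ℕ} (hp : p ≠ 0)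
    (h : OriginPath (· ∈ (0, none, w, q) :: L) F c p u v os) :
    OriginPath (CheckTrans Q A δ) F c p u v os := by
  have hne {t : NTrans} (ht : CheckTrans Q A δ t) : t.2.2.2 ≠ 0 := by
    cases ht <;> simp
  induction h with
  | nil hF => exact .nil hF
  | read ht _ ih =>
    rcases List.mem_cons.1 ht with ht | ht
    · simp at ht
    · rw [hL] at ht
      exact .read ht (ih (hne ht))
  | eps ht _ ih =>
    rcases List.mem_cons.1 ht with ht | ht
    · cases ht
      exact absurd rfl hp
    · rw [hL] at ht
      exact .eps ht (ih (hne ht))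

theorem exists_path_of_path_zero (hL : ∀ t, t ∈ L ↔ CheckTrans Q A δ t) (hq : q ≠ 0) (hF : ¬ F 0)
    (h : OriginPath (· ∈ (0, none, w, q) :: L) F c 0 u v os) :
    ∃ v' os', v = w ++ v' ∧ os = List.replicate w.length (max c 1) ++ os' ∧
      OriginPath (CheckTrans Q A δ) F c q u v' os' := by
  cases h with
  | nil h => exact absurd h hF
  | read ht h =>
    rcases List.mem_cons.1 ht with ht | ht
    · simp at ht
    · rw [hL] at ht
      cases ht
  | eps ht h =>
    rcases List.mem_cons.1 ht with ht | ht
    · cases ht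
      exact ⟨_, _, rfl, rfl, path_of_path_cons hL hq h⟩
    · rw [hL] at ht
      cases ht

end Prefixed

section Blocks
variable {δ : ℕ → ℕ → Option (ℕ × List ℕ)} {s : ℕ} {B : ℕ → List ℕ}

theorem exists_gsmRun_flatMap {i : ℕ} (h : ∀ j < i, gsmRun δ s (B j) = some (s, B (j + 1))) :
    ∃ o, gsmRun δ s ((List.range i).flatMap B) = some (s, o) ∧
      (List.range (i + 1)).flatMap B = B 0 ++ o := by
  induction i with
  | zero => exact ⟨[], rfl, by simp⟩
  | succ i ih =>
    obtain ⟨o, ho, hB⟩ := ih fun j hj => h j (hj.trans i.lt_succ_self)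
    refine ⟨o ++ B (i + 1), ?_, ?_⟩
    · rw [List.range_succ, List.flatMap_append, gsmRun_append_of_eq_some _ ho]
      simp [h i i.lt_succ_self]
    · rw [List.range_succ, List.flatMap_append, hB]
      simp

theorem gsmRun_copy {r : ℕ} (hr : ∀ a, δ r a = some (r, [a])) (u : List ℕ) :
    gsmRun δ r u = some (r, u) := by
  induction u with
  | nil => rfl
  | cons a u ih => simp [gsmRun, hr, ih]

end Blocks

theorem primrec_initWord (h b x e : ℕ) : Primrec (initWord h b x e) := by
  have hrep : Primrec fun n : ℕ => List.replicate n x := by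
    have : Primrec fun n : ℕ => Nat.rec (motive := fun _ => List ℕ) [] (fun _ l => x :: l) n :=
      Primrec.nat_rec₁ [] (Primrec.list_cons.comp (Primrec.const x) Primrec.snd).to₂
    refine this.of_eq fun n => ?_
    induction n with
    | zero => rfl
    | succ n ih => rw [List.replicate_succ, ← ih]
  exact Primrec.list_cons.comp (.const h) <| Primrec.list_cons.comp (.const b) <|
    Primrec.list_append.comp hrep (.const [e])

section Reduction

/-- The transducer that emits `w` and then anything, before or while reading its input. -/
def dumpNT (L : List NTrans) (w : List ℕ) : NT1 :=
  ((0, none, w, 1) :: L, [0], [1])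

/-- The transducer that checks that the output deviates from the input, or that the output is
`w ++ v` where `v` deviates from the output of the queue machine on the input. -/
noncomputable def checkNT (Q : Finset ℕ) (L : List NTrans) (s r : ℕ) (w : List ℕ) : NT1 :=
  ((0, none, w, s + 4) :: L, [0, r + 4], [1, 2, 3] ++ Q.toList.map (· + 4))

variable {Q A : Finset ℕ} {δ : ℕ → ℕ → Option (ℕ × List ℕ)} {L : List NTrans} {s r : ℕ}
  {conf : ℕ → Option (List ℕ)} {w : List ℕ}

theorem resyncLE_of_halts (hL : ∀ t, t ∈ L ↔ CheckTrans Q A δ t) (hδ : IsQueueStep Q A δ)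
    (hs : s ∈ Q) (hr : r ∈ Q) (hcopy : ∀ a, δ r a = some (r, [a])) (h0 : conf 0 = some w)
    (hconf : ∀ i, ∀ u ∈ conf i, u ≠ [] ∧ (∀ y ∈ u, y ∈ A) ∧
      gsmRun δ s u = (conf (i + 1)).map fun v => (s, v))
    (hhalt : ∃ i, conf i = none) : ResyncLE (OSem (dumpNT L w)) (OSem (checkNT Q L s r w)) := by
  obtain ⟨N, hN, hsome⟩ : ∃ N, conf (N + 1) = none ∧ ∀ i ≤ N, ∃ u, conf i = some u := by
    classical
    obtain ⟨N, hN⟩ : ∃ N, Nat.find hhalt = N + 1 :=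
      Nat.exists_eq_succ_of_ne_zero fun h => by
        have := Nat.find_spec hhalt
        simp [h, h0] at this
    exact ⟨N, hN ▸ Nat.find_spec hhalt, fun i hi =>
      Option.ne_none_iff_exists'.1 (Nat.find_min hhalt (by omega))⟩
  have hw : ∀ y ∈ w, y ∈ A := (hconf 0 w h0).2.1
  let B (i : ℕ) : List ℕ := (conf i).getD []
  have hB {i : ℕ} (hi : i ≤ N) : conf i = some (B i) := by
    obtain ⟨u, hu⟩ := hsome i hi
    simp [B, hu]
  have hB0 : B 0 = w := by simp [B, h0]
  have hstep (i : ℕ) (hi : i < N) : gsmRun δ s (B i) = some (s, B (i + 1)) := by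
    rw [(hconf i _ (hB hi.le)).2.2, hB hi, Option.map_some]
  have hlast : gsmRun δ s (B N) = none := by
    rw [(hconf N _ (hB le_rfl)).2.2, hN, Option.map_none]
  let P (i : ℕ) : List ℕ := (List.range i).flatMap B
  have hP {i : ℕ} (hi : i ≤ N) : ∃ o, gsmRun δ s (P i) = some (s, o) ∧ P (i + 1) = w ++ o :=
    hB0 ▸ exists_gsmRun_flatMap fun j hj => hstep j (hj.trans_le hi)
  have hPlast : gsmRun δ s (P (N + 1)) = none := by
    obtain ⟨o, ho, -⟩ := hP le_rfl
    have : P (N + 1) = P N ++ B N := by simp [P, List.range_succ]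
    rw [this, gsmRun_append_of_eq_some _ ho, hlast, Option.map_none]
  have hPlen {i : ℕ} (hi : i ≤ N + 1) : (P i).length ≤ (P (N + 1)).length := by
    obtain ⟨d, hd⟩ := Nat.exists_eq_add_of_le hi
    simp [P, hd, List.range_add]
  let K := (P (N + 1)).length
  have hK : 1 ≤ K := by
    have := (hconf N _ (hB le_rfl)).1
    have := List.length_pos_iff.2 this
    simp only [K, P, List.range_succ, List.flatMap_append, List.length_append,
      List.flatMap_singleton]
    omega
  refine ⟨0, sourceWithin ℕ 0 K, isRegularLang_sourceWithin K, boundedResync_sourceWithin K,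
    fun g₁ hg₁ => ?_⟩
  obtain ⟨q, hq, os₁, hpath, -⟩ := (mem_OSem_iff _ _).1 hg₁
  obtain rfl : q = 0 := by simpa [dumpNT] using hq
  obtain ⟨v', _, hv, -, hpath⟩ := exists_path_of_path_zero (F := (· ∈ [1])) hL one_ne_zero (by simp)
    hpath
  obtain ⟨hu, hv'⟩ := mem_letters_of_dump hpath
  suffices h : ∃ q ∈ [0, r + 4], ∃ os, OriginPath (· ∈ (checkNT Q L s r w).1)
      (· ∈ (checkNT Q L s r w).2.2) 0 q g₁.inp g₁.out os ∧ ∀ x ∈ os, x ≤ K by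
    obtain ⟨q, hq, os, hos, hle⟩ := h
    obtain ⟨g, hg, hgi, hgo, hmem⟩ := hos.exists_mem_OSem hq g₁.inp_ne
    refine ⟨g, hg, hgi, hgo, fun _ _ => false, fun z h1 h2 => ?_⟩
    have := g.orig_mem z h1 (hgo ▸ h2)
    exact rSat_sourceWithin_iff.2 ⟨this.1, this.2, hle _ (hmem z h1 h2)⟩
  have hcheck (q : ℕ) (hq : q ∈ Q) (v : List ℕ) (hv : ∀ a ∈ v, a ∈ A)
      (h : g₁.inp.length ≤ K ∨ ¬ ∃ q' o, gsmRun δ q (g₁.inp.take K) = some (q', o) ∧ o <+: v) :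
      ∃ os, OriginPath (· ∈ (checkNT Q L s r w).1) (· ∈ (checkNT Q L s r w).2.2) 0 (q + 4)
        g₁.inp v os ∧ ∀ x ∈ os, x ≤ K := by
    obtain ⟨os, hos, hle⟩ := exists_path_of_not_isPrefix (F := (· ∈ (checkNT Q L s r w).2.2)) hδ
      (by simp [checkNT]) (by simp [checkNT]) (by simp [checkNT]) (by simp [checkNT]) hu hv hq 0 K h
    refine ⟨os, hos.mono fun t ht => List.mem_cons_of_mem _ ((hL t).2 ht), fun x hx => ?_⟩
    have := hle x hx
    omega
  by_cases hcase : g₁.inp.length ≤ K ∨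
      ¬ ∃ q' o, gsmRun δ r (g₁.inp.take K) = some (q', o) ∧ o <+: g₁.out
  · obtain ⟨os, hos, hle⟩ := hcheck r hr g₁.out
      (by simpa [hv, or_imp, forall_and] using ⟨hw, hv'⟩) hcase
    exact ⟨r + 4, by simp, os, hos, hle⟩
  · rw [not_or, not_not, not_le] at hcase
    obtain ⟨hlen, q', o, hrun, hpre⟩ := hcase
    rw [gsmRun_copy hcopy] at hrun
    cases hrun
    have hplen : (g₁.inp.take K).length = K := by simp [hlen.le]
    obtain ⟨os, hos, hle⟩ := hcheck s hs v' hv' <| .inr <| by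
      rintro ⟨q', o, hrun, ho⟩
      have hPre (i : ℕ) (hi : i ≤ N + 1) : P i <+: g₁.inp.take K := by
        induction i with
        | zero => exact ⟨_, rfl⟩
        | succ i ih =>
          obtain ⟨t, ht⟩ := ih (by omega)
          obtain ⟨o', ho', hPo⟩ := hP (Nat.le_of_succ_le_succ hi)
          rw [← ht, gsmRun_append_of_eq_some _ ho', Option.map_eq_some_iff] at hrun
          obtain ⟨p, -, hp⟩ := hrun
          cases hp
          refine List.prefix_of_prefix_length_le ?_ hpre ((hPlen hi).trans_eq hplen.symm)
          rw [hPo, hv]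
          exact (List.prefix_append_right_inj w).2 ((List.prefix_append _ _).trans ho)
      obtain ⟨t, ht⟩ := hPre (N + 1) le_rfl
      rw [← ht, gsmRun_append_of_eq_none _ hPlast] at hrun
      cases hrun
    have hpath := OriginPath.eps (P := (· ∈ (checkNT Q L s r w).1)) (q := 0) (w := w)
      List.mem_cons_self hos
    rw [← hv] at hpath
    refine ⟨0, by simp, _, hpath, fun x hx => ?_⟩
    rcases List.mem_append.1 hx with hx | hx
    · have := List.eq_of_mem_replicate hx
      omega
    · exact hle x hx

theorem not_resyncLE_of_not_halts (hL : ∀ t, t ∈ L ↔ CheckTrans Q A δ t) (hδ : IsQueueStep Q A δ)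
    (hcopy : ∀ a, δ r a = some (r, [a])) (h0 : conf 0 = some w)
    (hconf : ∀ i, ∀ u ∈ conf i, u ≠ [] ∧ (∀ y ∈ u, y ∈ A) ∧
      gsmRun δ s u = (conf (i + 1)).map fun v => (s, v))
    (hhalt : ¬ ∃ i, conf i = none) : ¬ ResyncLE (OSem (dumpNT L w)) (OSem (checkNT Q L s r w)) := by
  rintro ⟨m, γ, -, ⟨k, hk⟩, hle⟩
  let B (i : ℕ) : List ℕ := (conf i).getD []
  have hB (i : ℕ) : conf i = some (B i) := by
    obtain ⟨u, hu⟩ := Option.ne_none_iff_exists'.1 (not_exists.1 hhalt i)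
    simp [B, hu]
  have hB0 : B 0 = w := by simp [B, h0]
  let P (i : ℕ) : List ℕ := (List.range i).flatMap B
  have hP (i : ℕ) : ∃ o, gsmRun δ s (P i) = some (s, o) ∧ P (i + 1) = w ++ o :=
    hB0 ▸ exists_gsmRun_flatMap fun j _ => by rw [(hconf j _ (hB j)).2.2, hB, Option.map_some]
  have hPsucc (i : ℕ) : P (i + 1) = P i ++ B i := by simp [P, List.range_succ]
  have hPlen (i : ℕ) : i ≤ (P i).length := by
    induction i with
    | zero => simp
    | succ i ih =>
      have := List.length_pos_iff.2 (hconf i _ (hB i)).1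
      rw [hPsucc, List.length_append]
      omega
  have hPA (i : ℕ) : ∀ y ∈ P i, y ∈ A := by
    intro y hy
    obtain ⟨j, -, hj⟩ := List.mem_flatMap.1 hy
    exact (hconf j _ (hB j)).2.1 y hj
  let M := w.length + 2 * k
  let u := P (M + 1)
  have hu : M + 1 ≤ u.length := hPlen (M + 1)
  obtain ⟨v', hv', huv⟩ : ∃ v', (∃ o, gsmRun δ s u = some (s, o) ∧ v' <+: o) ∧ u = w ++ v' := by
    obtain ⟨o, ho, hPo⟩ := hP M
    refine ⟨o, ?_, hPo⟩
    obtain ⟨o', ho', hPo'⟩ := hP (M + 1)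
    refine ⟨o', ho', (List.prefix_append_right_inj w).1 ?_⟩
    rw [← hPo, ← hPo', hPsucc (M + 1)]
    exact List.prefix_append _ _
  have hune : u ≠ [] := List.length_pos_iff.1 (by omega)
  obtain ⟨g₁, hg₁, hgi, hgo, horig⟩ : ∃ g ∈ OSem (dumpNT L w), g.inp = u ∧ g.out = u ∧
      ∀ z, 1 ≤ z → z ≤ u.length → g.orig z = 1 := by
    have hdump := exists_path_dump (Q := Q) (δ := δ) (F := (· ∈ [1])) (v := v') (hPA (M + 1))
      (fun a ha => hPA (M + 1) a (by change a ∈ u; simp [huv, ha])) (by simp) 0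
    have hpath : OriginPath (· ∈ (dumpNT L w).1) (· ∈ [1]) 0 0 u u
        (List.replicate w.length (max 0 1) ++ List.replicate v'.length (max 0 1)) := by
      have := OriginPath.eps (P := (· ∈ (dumpNT L w).1)) (q := 0) (w := w) List.mem_cons_self
        (hdump.mono fun t ht => List.mem_cons_of_mem _ ((hL t).2 ht))
      rwa [← huv] at this
    obtain ⟨g, hg, h1, h2, h3⟩ := hpath.exists_mem_OSem (T := dumpNT L w)
      (by simp [dumpNT]) hune
    exact ⟨g, hg, h1, h2, fun z hz hz' => by
      have := h3 z hz hz'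
      simp only [List.mem_append, List.mem_replicate] at this
      omega⟩
  obtain ⟨g₂, hg₂, hi, ho, I, hI⟩ := hle g₁ hg₁
  rw [hgi] at hi
  rw [hgo] at ho hI
  rw [hi] at hI
  obtain ⟨q, hq, os, hpath, hos⟩ := (mem_OSem_iff _ _).1 hg₂
  rw [hi, ho] at hpath
  rw [ho] at hos
  have hcard (os' : List ℕ) (h : os' ⊆ os) : os'.toFinset.card ≤ k := by
    rw [← Set.ncard_coe_finset]
    refine (Set.ncard_le_ncard ?_ ?_).trans (hk u I 1 le_rfl (by omega))
    · intro x hx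
      have hx : x ∈ os := h (by simpa using hx)
      obtain ⟨i, hi', rfl⟩ := List.getElem_of_mem hx
      have hiu : i + 1 ≤ u.length := by rw [← hpath.length_eq]; omega
      have heq : g₂.orig (i + 1) = os[i] := by
        rw [hos (i + 1) (by omega) hiu, Nat.add_sub_cancel, List.getD_eq_getElem]
      have := g₂.orig_mem (i + 1) (by omega) (by rw [ho]; exact hiu)
      rw [heq, hi] at this
      refine ⟨this.1, this.2, ?_⟩
      have := hI (i + 1) (by omega) hiu
      rwa [heq, horig _ (by omega) hiu] at this
    · exact (Set.finite_Icc 1 u.length).subset fun x hx => ⟨hx.1, hx.2.1⟩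
  rcases List.mem_pair.1 hq with rfl | rfl
  · obtain ⟨v₂, os', hv₂, rfl, hpath⟩ := exists_path_of_path_zero hL (by simp)
      (by simp [checkNT]) hpath
    obtain rfl : v' = v₂ := List.append_cancel_left (huv.symm.trans hv₂)
    obtain ⟨o, ho', hvo⟩ := hv'
    have h1 := (length_le_of_isPrefix hδ hpath ho' hvo).2
    have h2 := hcard os' (List.subset_append_right _ _)
    rw [hpath.length_eq] at h1
    rw [huv, List.length_append] at hu
    omega
  · have hpath := path_of_path_cons hL (by simp) hpath
    have h1 := (length_le_of_isPrefix hδ hpath (gsmRun_copy hcopy u) (List.prefix_refl u)).2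
    have h2 := hcard os (List.Subset.refl _)
    rw [hpath.length_eq] at h1
    omega

end Reduction

/-- Containment up to an unknown bounded regular resynchronizer is undecidable for
one-way nondeterministic transducers: no algorithm decides, given two 1NTs `T₁, T₂`,
whether `T₁ ⪯ T₂`, i.e., whether there is a bounded regular resynchronizer `R` with
`⟦T₁⟧ᵒ ⊆ R(⟦T₂⟧ᵒ)`. -/
theorem resyncLE_undecidable :
    ¬ ComputablePred fun p : NT1 × NT1 => ResyncLE (OSem p.1) (OSem p.2) := by
  obtain ⟨Q, A, δ, s, r, h, b, x, e, conf, hs, hr, hcopy, hδ, hconf⟩ := exists_queueMachine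
  let L : List NTrans := (finite_checkTrans hδ).toFinset.toList
  have hL (t : NTrans) : t ∈ L ↔ CheckTrans Q A δ t := by simp [L]
  let w (c : Nat.Partrec.Code) : List ℕ := initWord h b x e (Encodable.encode c)
  have hw : Computable w := ((primrec_initWord h b x e).comp Primrec.encode).to_comp
  have htrans (q : ℕ) : Computable fun c => ((0, none, w c, q) :: L : List NTrans) :=
    Computable.list_cons.comp (.pair (.const 0) (.pair (.const none) (.pair hw (.const q))))
      (.const L)
  refine fun hdec => ComputablePred.halting_problem 0 <|
    ComputablePred.computable_of_manyOneReducible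
      ⟨fun c => (dumpNT L (w c), checkNT Q L s r (w c)), ?_, fun c => ?_⟩ hdec
  · exact .pair ((htrans _).pair (.const _)) ((htrans _).pair (.const _))
  · obtain ⟨h0, hstep, hhalt⟩ := hconf (Encodable.encode c)
    rw [Denumerable.ofNat_encode] at hhalt
    refine hhalt.symm.trans ?_
    exact ⟨resyncLE_of_halts hL hδ hs hr hcopy h0 hstep,
      not_imp_not.1 (not_resyncLE_of_not_halts hL hδ hcopy h0 hstep)⟩
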